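/- arXiv:0811.0747 — 2 statements merged into one kernel-verified Lean document; each statement's English description precedes it below -/
import Mathlib

section
/- Let L be a sublattice of the Boolean lattice of all subsets of {1,...,n} (closed under union and intersection) containing ∅ and {1,...,n}, and let K be a field. Let B̃ be the matrix over K whose rows are the indicator vectors in K^n of the elements of L. Then rank(B̃) = rank(L), where rank(L) is the nonnegative integer l such that l+1 is the maximal cardinality of a chain in L. -/
/-- `L` has rank `l`: the maximal cardinality of a chain in `L` is `l + 1`. -/
def LatticeRankIs {n : ℕ} (L : Set (Finset (Fin n))) (l : ℕ) : Prop :=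
  IsGreatest {k | ∃ c : Finset (Finset (Fin n)), ↑c ⊆ L ∧
    IsChain (· ⊆ ·) (c : Set (Finset (Fin n))) ∧ c.card = k} (l + 1)

open Finset in
theorem chain_linInd {K : Type*} [Field K] {n : ℕ} (c : Finset (Finset (Fin n)))
    (hc : IsChain (· ⊆ ·) (c : Set (Finset (Fin n)))) (h0 : ∅ ∉ c) :
    LinearIndependent K (fun (S : ↥c) (j : Fin n) => if j ∈ S.1 then (1 : K) else 0) := by
  classical
  have key : ∀ C ∈ c, ∃ x ∈ C, ∀ D ∈ c, x ∈ D → C ⊆ D := by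
    intro C hC
    by_cases hne : (c.filter (· ⊂ C)).Nonempty
    · obtain ⟨D, hD, hmax⟩ := exists_max_image (c.filter (· ⊂ C)) Finset.card hne
      rw [mem_filter] at hD
      obtain ⟨x, hxC, hxD⟩ := Finset.exists_of_ssubset hD.2
      refine ⟨x, hxC, fun E hE hxE => ?_⟩
      by_contra hCE
      have hEC : E ⊆ C := (hc.total hC hE).resolve_left hCE
      have h1 := hmax E (mem_filter.2 ⟨hE, hEC, hCE⟩)
      rcases hc.total hE hD.1 with h | h
      · exact hxD (h hxE)
      · exact hxD (Finset.eq_of_subset_of_card_le h h1 ▸ hxE)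
    · obtain ⟨x, hx⟩ : C.Nonempty := by
        rw [nonempty_iff_ne_empty]; rintro rfl; exact h0 hC
      refine ⟨x, hx, fun E hE hxE => ?_⟩
      by_contra hCE
      have hEC : E ⊆ C := (hc.total hC hE).resolve_left hCE
      exact hne ⟨E, mem_filter.2 ⟨hE, hEC, hCE⟩⟩
  rw [Fintype.linearIndependent_iff]
  intro a ha
  have main : ∀ m : ℕ, ∀ C : ↥c, n - C.1.card = m → a C = 0 := by
    intro m
    induction m using Nat.strong_induction_on with
    | _ m ih =>
      intro C hCm
      obtain ⟨x, hxC, hx⟩ := key C.1 C.2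
      have h := congrFun ha x
      simp only [Finset.sum_apply, Pi.smul_apply, smul_eq_mul, Pi.zero_apply] at h
      rw [Finset.sum_eq_single C] at h
      · simpa [hxC] using h
      · intro D _ hDC
        by_cases hxD : x ∈ D.1
        · have hsub := hx D.1 D.2 hxD
          have hss : C.1 ⊂ D.1 := lt_of_le_of_ne hsub (fun h => hDC (Subtype.ext h.symm))
          have h1 := Finset.card_lt_card hss
          have h2 := Finset.card_le_univ D.1
          rw [Fintype.card_fin] at h2
          rw [ih (n - D.1.card) (by omega) D rfl, zero_mul]
        · simp [hxD]
      · intro h; exact absurd (mem_univ _) h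
  exact fun C => main _ C rfl

/-- **Lemma 3.2.** Let `L` be a sublattice of the Boolean lattice of subsets of
`{1,…,n}` containing `∅` and `{1,…,n}`, and let `B̃` be the matrix over a field
`K` whose rows are the indicator vectors of the elements of `L`. Then
`rank B̃ = rank L`. -/
theorem rank_indicatorMatrix_eq_latticeRank {K : Type*} [Field K] {n : ℕ}
    (L : Finset (Finset (Fin n)))
    (hbot : ∅ ∈ L) (htop : Finset.univ ∈ L)
    (hclosed : ∀ S ∈ L, ∀ T ∈ L, S ∪ T ∈ L ∧ S ∩ T ∈ L)
    (l : ℕ) (hl : LatticeRankIs (↑L : Set (Finset (Fin n))) l) :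
    (Matrix.of fun (S : ↥L) (j : Fin n) => if j ∈ S.1 then (1 : K) else 0).rank
      = l := by
  classical
  obtain ⟨⟨c, hcL, hc, hcard⟩, hmax⟩ := hl
  have hins : ∀ M ∈ L, (∀ C ∈ c, C ⊆ M ∨ M ⊆ C) → M ∈ c := by
    intro M hM hcomp
    by_contra hMc
    have := hmax (a := l + 2) ⟨insert M c, by
      rw [Finset.coe_insert]; exact Set.insert_subset hM hcL, by
      rw [Finset.coe_insert]
      exact hc.insert (fun C hC _ => (hcomp C hC).symm), by
      rw [Finset.card_insert_of_notMem hMc, hcard]⟩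
    omega
  have h0 : ∅ ∈ c := hins _ hbot (fun C _ => Or.inr (Finset.empty_subset C))
  have h1 : Finset.univ ∈ c := hins _ htop (fun C _ => Or.inl (Finset.subset_univ C))
  have hsup : ∀ s : Finset (Finset (Fin n)), s ⊆ L → s.sup id ∈ L := by
    intro s hs
    exact Finset.sup_induction (p := (· ∈ L)) hbot (fun S hS T hT => (hclosed S hS T hT).1)
      (fun S hS => hs hS)
  have hinf : ∀ s : Finset (Finset (Fin n)), s ⊆ L → s.inf id ∈ L := by
    intro s hs
    exact Finset.inf_induction (p := (· ∈ L)) htop (fun S hS T hT => (hclosed S hS T hT).2)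
      (fun S hS => hs hS)
  have hcL' : c ⊆ L := fun x hx => hcL hx
  have hsep : ∀ x y : Fin n, (∀ C ∈ c, x ∈ C ↔ y ∈ C) → ∀ S ∈ L, x ∈ S → y ∈ S := by
    intro x y hxy S hS hxS
    by_contra hyS
    set T := (c.filter (x ∈ ·)).inf id with hT
    set A := (c.filter (x ∉ ·)).sup id with hA
    have hTL : T ∈ L := hinf _ ((Finset.filter_subset _ _).trans hcL')
    have hAL : A ∈ L := hsup _ ((Finset.filter_subset _ _).trans hcL')
    have hxT : x ∈ T := by
      rw [hT, Finset.mem_inf]; intro C hC; exact (Finset.mem_filter.1 hC).2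
    have hyA : y ∉ A := by
      rw [hA, Finset.mem_sup]; rintro ⟨C, hC, hyC⟩
      rw [Finset.mem_filter] at hC
      exact hC.2 ((hxy C hC.1).2 hyC)
    have hAT : A ⊆ T := by
      apply Finset.sup_le
      intro D hD
      apply Finset.le_inf
      intro C hC
      rw [Finset.mem_filter] at hC hD
      rcases hc.total hD.1 hC.1 with h | h
      · exact h
      · exact absurd (h hC.2) hD.2
    have hM : A ∪ (T ∩ S) ∈ c := by
      apply hins _ (hclosed _ hAL _ (hclosed _ hTL _ hS).2).1
      intro C hC
      by_cases hxC : x ∈ C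
      · right
        have hTC : T ⊆ C := Finset.inf_le (f := id) (Finset.mem_filter.2 ⟨hC, hxC⟩)
        exact Finset.union_subset (hAT.trans hTC) (Finset.inter_subset_left.trans hTC)
      · left
        have hCA : C ⊆ A := Finset.le_sup (f := id) (Finset.mem_filter.2 ⟨hC, hxC⟩)
        exact hCA.trans Finset.subset_union_left
    have := (hxy _ hM).1 (by simp [hxT, hxS])
    simp [hyA, hyS] at this
  apply le_antisymm
  · rw [Matrix.rank_eq_finrank_span_cols]
    set M : Matrix L (Fin n) K :=
      Matrix.of fun (S : ↥L) (j : Fin n) => if j ∈ S.1 then (1 : K) else 0 with hMdef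
    let f : Fin n → ℕ := fun x => (c.filter (x ∈ ·)).card
    have hf : ∀ x, f x ∈ Finset.Icc 1 l := by
      intro x
      rw [Finset.mem_Icc]
      constructor
      · exact Finset.card_pos.2 ⟨_, Finset.mem_filter.2 ⟨h1, Finset.mem_univ x⟩⟩
      · have : c.filter (x ∈ ·) ⊂ c :=
          Finset.filter_ssubset.2 ⟨∅, h0, Finset.notMem_empty x⟩
        have := Finset.card_lt_card this
        change (c.filter (x ∈ ·)).card ≤ l
        omega
    have hfe : ∀ x y, f x = f y → ∀ C ∈ c, x ∈ C ↔ y ∈ C := by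
      intro x y hxy
      have hnest : c.filter (x ∈ ·) ⊆ c.filter (y ∈ ·) ∨ c.filter (y ∈ ·) ⊆ c.filter (x ∈ ·) := by
        by_contra! hcon
        obtain ⟨h, h'⟩ := hcon
        rw [Finset.not_subset] at h h'
        obtain ⟨C, hC, hC'⟩ := h
        obtain ⟨D, hD, hD'⟩ := h'
        simp only [Finset.mem_filter, not_and] at hC hC' hD hD'
        rcases hc.total hC.1 hD.1 with h | h
        · exact hD' hD.1 (h hC.2)
        · exact hC' hC.1 (h hD.2)
      have heq : c.filter (x ∈ ·) = c.filter (y ∈ ·) := by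
        rcases hnest with h | h
        · exact Finset.eq_of_subset_of_card_le h hxy.ge
        · exact (Finset.eq_of_subset_of_card_le h hxy.le).symm
      intro C hC
      have := Finset.ext_iff.1 heq C
      simpa [hC] using this
    have hfac : Function.FactorsThrough M.col f := by
      intro x y hxy
      have h := hfe x y hxy
      funext S
      have hiff : x ∈ S.1 ↔ y ∈ S.1 :=
        ⟨hsep x y h S.1 S.2, hsep y x (fun C hC => (h C hC).symm) S.1 S.2⟩
      simp [hMdef, Matrix.col, hiff]
    have hsub : Set.range M.col ⊆ ((Finset.Icc 1 l).image (Function.extend f M.col 0) : Finset _) := by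
      rintro _ ⟨j, rfl⟩
      rw [Finset.mem_coe, Finset.mem_image]
      exact ⟨f j, hf j, hfac.extend_apply 0 j⟩
    calc _ ≤ _ := Submodule.finrank_mono (Submodule.span_mono hsub)
      _ ≤ _ := finrank_span_finset_le_card _
      _ ≤ _ := Finset.card_image_le
      _ = l := by simp
  · rw [Matrix.rank_eq_finrank_span_row]
    have hli := chain_linInd (K := K) (c.erase ∅)
      (hc.mono (by exact_mod_cast Finset.erase_subset _ _)) (Finset.notMem_erase _ _)
    have hfr := finrank_span_eq_card hli
    rw [Fintype.card_coe, Finset.card_erase_of_mem h0, hcard, Nat.add_sub_cancel] at hfr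
    rw [← hfr]
    apply Submodule.finrank_mono
    apply Submodule.span_mono
    rintro _ ⟨S, rfl⟩
    exact ⟨⟨S.1, hcL' (Finset.mem_of_mem_erase S.2)⟩, rfl⟩
end

section
/- Let L be a sublattice of the Boolean lattice of all subsets of {1,...,n} (closed under union and intersection) containing ∅ and {1,...,n}, let K be a field, and let M be a maximal chain in L (a chain not properly contained in any other chain of L). Then for every S ∈ L, the indicator vector of S in K^n lies in the K-linear span of the indicator vectors of the elements of M. -/
/-- The upper-bound half of the proof of **Lemma 3.2**: if `L` is a sublattice of
the Boolean lattice of subsets of `{1,…,n}` containing `∅` and `{1,…,n}`, and `M`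
is a maximal chain in `L`, then the indicator vector in `K^n` of every element of
`L` lies in the `K`-linear span of the indicator vectors of the elements of `M`. -/
theorem indicator_mem_span_of_maximal_chain {K : Type*} [Field K] {n : ℕ}
    (L M : Set (Finset (Fin n)))
    (hbot : ∅ ∈ L) (htop : Finset.univ ∈ L)
    (hclosed : ∀ S ∈ L, ∀ T ∈ L, S ∪ T ∈ L ∧ S ∩ T ∈ L)
    (hML : M ⊆ L) (hchain : IsChain (· ⊆ ·) M)
    (hmax : ∀ M' : Set (Finset (Fin n)), M ⊆ M' → M' ⊆ L →
      IsChain (· ⊆ ·) M' → M' = M)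
    (S : Finset (Fin n)) (hS : S ∈ L) :
    (fun j : Fin n => if j ∈ S then (1 : K) else 0) ∈
      Submodule.span K
        ((fun (T : Finset (Fin n)) (j : Fin n) =>
          if j ∈ T then (1 : K) else 0) '' M) := by
  have hins : ∀ U ∈ L, (∀ V ∈ M, U ⊆ V ∨ V ⊆ U) → U ∈ M := by
    intro U hU h
    have := hmax (insert U M) (Set.subset_insert _ _) (Set.insert_subset hU hML)
      (hchain.insert fun V hV _ => h V hV)
    rw [← this]
    exact Set.mem_insert _ _
  have hbM : ∅ ∈ M := hins _ hbot fun V _ => Or.inl (Finset.empty_subset V)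
  have htM : Finset.univ ∈ M := hins _ htop fun V _ => Or.inr (Finset.subset_univ V)
  set f : Finset (Fin n) → Fin n → K := fun T j => if j ∈ T then (1 : K) else 0 with hf
  have key : ∀ k : ℕ, ∀ T ∈ M, T.card = k → f (S ∩ T) ∈ Submodule.span K (f '' M) := by
    intro k
    induction k using Nat.strong_induction_on with
    | _ k ih =>
      intro T hT hk
      by_cases hTe : T = ∅
      · subst hTe
        rw [Finset.inter_empty]
        exact Submodule.subset_span ⟨_, hbM, rfl⟩
      obtain ⟨T', ⟨hT'M, hT'T⟩, hT'max⟩ := Set.exists_max_image {V | V ∈ M ∧ V ⊂ T}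
        Finset.card (Set.toFinite _)
        ⟨∅, hbM, Finset.empty_ssubset.mpr (Finset.nonempty_iff_ne_empty.mpr hTe)⟩
      have ih' := ih T'.card (hk ▸ Finset.card_lt_card hT'T) T' hT'M rfl
      have hgap : ∀ V ∈ M, V ⊂ T → T' ⊆ V → T' = V := fun V hV hVT h =>
        Finset.eq_of_subset_of_card_le h (hT'max V ⟨hV, hVT⟩)
      have hUT : S ∩ T ∪ T' ⊆ T := Finset.union_subset Finset.inter_subset_right hT'T.subset
      have hU : S ∩ T ∪ T' ∈ M := by
        apply hins
        · exact (hclosed _ (hclosed _ hS _ (hML hT)).2 _ (hML hT'M)).1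
        · intro V hV
          rcases hchain.total hT hV with h | h
          · exact Or.inl (hUT.trans h)
          · rcases h.eq_or_ssubset with h | h
            · exact Or.inl (h ▸ hUT)
            · right
              rcases hchain.total hT'M hV with h' | h'
              · rw [← hgap V hV h h']
                exact Finset.subset_union_right
              · exact h'.trans Finset.subset_union_right
      rcases hUT.eq_or_ssubset with h | h
      · have e : f (S ∩ T) = f (S ∩ T') + (f T - f T') := by
          funext j
          have h1 := Finset.ext_iff.mp h j
          have h2 : j ∈ T' → j ∈ T := fun q => hT'T.subset q
          simp only [Finset.mem_union, Finset.mem_inter] at h1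
          simp only [hf, Pi.add_apply, Pi.sub_apply, Finset.mem_inter]
          by_cases a : j ∈ S <;> by_cases b : j ∈ T <;> by_cases c : j ∈ T' <;>
            simp only [a, b, c] at h1 h2 ⊢ <;> simp at h1 h2 ⊢
        rw [e]
        exact Submodule.add_mem _ ih' (Submodule.sub_mem _
          (Submodule.subset_span ⟨_, hT, rfl⟩) (Submodule.subset_span ⟨_, hT'M, rfl⟩))
      · have h0 := hgap _ hU h Finset.subset_union_right
        have e : S ∩ T = S ∩ T' := by
          ext j
          have h1 := Finset.ext_iff.mp h0 j
          have h2 : j ∈ T' → j ∈ T := fun q => hT'T.subset q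
          simp only [Finset.mem_union, Finset.mem_inter] at h1 ⊢
          tauto
        rw [e]
        exact ih'
  have := key _ _ htM rfl
  rwa [Finset.inter_univ] at this
end
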